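/- arXiv:2402.14276 — 3 statements merged into one kernel-verified Lean document; each statement's English description precedes it below -/
import Mathlib

section
/- Let η ∈ (0, 1/√12] and let g : ℝ² → ℂ be continuously differentiable. Let τ be uniformly distributed on [−√3η, √3η] and define g_η(ω₁,ω₂) = E_τ[(1−τ)³ g((1−τ)ω₁,(1−τ)ω₂)]. Then for every r > 0 and θ, g_η is differentiable in the radial variable and 2√3 η (4 g_η(r,θ) + r ∂_r g_η(r,θ)) = (1+√3η)⁴ g((1+√3η)r, θ) − (1−√3η)⁴ g((1−√3η)r, θ). -/
open MeasureTheory Complex Real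

/-- Polar coordinates: the point of `ℝ²` at radius `r` and angle `θ`. -/
noncomputable def polar (r θ : ℝ) : ℝ × ℝ := (r * Real.cos θ, r * Real.sin θ)

/-- Rescaling a weighted dilation average to an integral over `[(1 - a) s, (1 + a) s]`. -/
theorem integral_dilation_eq (h : ℝ → ℂ) (a : ℝ) {s : ℝ} (hs : s ≠ 0) :
    ∫ τ in (-a)..a, ((1 : ℂ) - τ) ^ 3 * h ((1 - τ) * s)
      = ((s : ℂ) ^ 4)⁻¹ * ∫ t in ((1 - a) * s)..((1 + a) * s), (t : ℂ) ^ 3 * h t := by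
  have hs' : (s : ℂ) ≠ 0 := by exact_mod_cast hs
  have key := intervalIntegral.integral_comp_sub_mul (a := -a) (b := a)
    (fun t : ℝ => (t : ℂ) ^ 3 * h t) hs s
  have hint : ∀ τ : ℝ, ((1 : ℂ) - τ) ^ 3 * h ((1 - τ) * s)
      = ((s : ℂ) ^ 3)⁻¹ * (((s - s * τ : ℝ) : ℂ) ^ 3 * h (s - s * τ)) := by
    intro τ
    rw [show s - s * τ = (1 - τ) * s by ring]
    push_cast
    field_simp
  simp_rw [hint]
  rw [intervalIntegral.integral_const_mul, key, show s - s * a = (1 - a) * s by ring,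
    show s - s * -a = (1 + a) * s by ring, Complex.real_smul, ← mul_assoc]
  congr 1
  push_cast
  field_simp

/-- A continuous integrand gives a differentiable integral over `[(1 - a) s, (1 + a) s]`. -/
theorem hasDerivAt_integral_dilation {f : ℝ → ℂ} (hf : Continuous f) (a r : ℝ) :
    HasDerivAt (fun s : ℝ => ∫ t in ((1 - a) * s)..((1 + a) * s), f t)
      (((1 + a : ℝ) : ℂ) * f ((1 + a) * r) - ((1 - a : ℝ) : ℂ) * f ((1 - a) * r)) r := by
  have hG : ∀ c : ℝ, HasDerivAt (fun s : ℝ => ∫ t in (0 : ℝ)..(c * s), f t)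
      ((c : ℂ) * f (c * r)) r := by
    intro c
    have h1 : HasDerivAt (fun s : ℝ => c * s) c r := by
      simpa using (hasDerivAt_id r).const_mul c
    have h2 := (hf.integral_hasStrictDerivAt 0 (c * r)).hasDerivAt
    simpa [Function.comp_def, Complex.real_smul] using HasDerivAt.scomp r h2 h1
  refine ((hG (1 + a)).sub (hG (1 - a))).congr_of_eventuallyEq (Filter.Eventually.of_forall ?_)
  intro s
  exact (intervalIntegral.integral_interval_sub_left (hf.intervalIntegrable _ _)
    (hf.intervalIntegrable _ _)).symm

/-- Let `η ∈ (0, 1/√12]`, `g : ℝ² → ℂ` continuously differentiable, `τ` uniform on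
`[-√3η, √3η]` and `g_η(ω) = E_τ[(1-τ)³ g((1-τ)ω)]`. Then for `r > 0` and `θ`, `g_η` is
differentiable in the radial variable and
`2√3η (4 g_η(r,θ) + r ∂_r g_η(r,θ)) = (1+√3η)⁴ g((1+√3η)r, θ) - (1-√3η)⁴ g((1-√3η)r, θ)`. -/
theorem stmt4 (η : ℝ) (hη : 0 < η) (hη' : η ≤ 1 / Real.sqrt 12)
    (g : ℝ × ℝ → ℂ) (hg : ContDiff ℝ 1 g)
    (gη : ℝ × ℝ → ℂ)
    (hgη : ∀ ω : ℝ × ℝ, gη ω = (2 * Real.sqrt 3 * η)⁻¹ •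
      ∫ τ in (-(Real.sqrt 3 * η))..(Real.sqrt 3 * η), ((1 : ℂ) - τ)^3 * g ((1 - τ) • ω))
    (r θ : ℝ) (hr : 0 < r) :
    ∃ d : ℂ, HasDerivAt (fun s : ℝ => gη (polar s θ)) d r ∧
      ((2 * Real.sqrt 3 * η : ℝ) : ℂ) * (4 * gη (polar r θ) + (r : ℂ) * d)
        = ((1 + Real.sqrt 3 * η : ℝ) : ℂ)^4 * g (polar ((1 + Real.sqrt 3 * η) * r) θ)
          - ((1 - Real.sqrt 3 * η : ℝ) : ℂ)^4 * g (polar ((1 - Real.sqrt 3 * η) * r) θ) := by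
  set a : ℝ := Real.sqrt 3 * η with ha
  have ha0 : 0 < a := by positivity
  have hpolar : ∀ c s : ℝ, c • polar s θ = polar (c * s) θ := by
    intro c s
    simp [polar, mul_assoc]
  have hf : Continuous fun t : ℝ => (t : ℂ) ^ 3 * g (polar t θ) := by
    have hp : Continuous fun t : ℝ => polar t θ := by
      unfold polar
      fun_prop
    have hgc := hg.continuous
    fun_prop
  set F : ℝ → ℂ := fun s => ∫ t in ((1 - a) * s)..((1 + a) * s), (t : ℂ) ^ 3 * g (polar t θ)
    with hF
  have heq : ∀ s : ℝ, s ≠ 0 →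
      gη (polar s θ) = ((2 * a : ℝ) : ℂ)⁻¹ * (((s : ℂ) ^ 4)⁻¹ * F s) := by
    intro s hs
    rw [hgη, mul_assoc, ← ha, Complex.real_smul, Complex.ofReal_inv, hF,
      ← integral_dilation_eq (fun t => g (polar t θ)) a hs]
    simp_rw [hpolar]
  have hr' : (r : ℂ) ≠ 0 := by exact_mod_cast hr.ne'
  have ha' : (a : ℂ) ≠ 0 := by exact_mod_cast ha0.ne'
  have hpow : HasDerivAt (fun s : ℝ => ((s : ℂ) ^ 4)⁻¹)
      (-(4 * (r : ℂ) ^ 3) / ((r : ℂ) ^ 4) ^ 2) r := by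
    have h4 : HasDerivAt (fun s : ℝ => (s : ℂ) ^ 4) (4 * (r : ℂ) ^ 3) r := by
      simpa using (hasDerivAt_pow 4 (r : ℂ)).comp_ofReal
    exact h4.inv (pow_ne_zero 4 hr')
  have hder := (hpow.mul (hasDerivAt_integral_dilation hf a r)).const_mul ((2 * a : ℝ) : ℂ)⁻¹
  refine ⟨_, hder.congr_of_eventuallyEq ?_, ?_⟩
  · filter_upwards [isOpen_ne.mem_nhds hr.ne'] with s hs
    exact heq s hs
  · rw [heq r hr.ne', mul_assoc 2, ← ha]
    change _ * (4 * (_ * (_ * F r)) + _ * (_ * (_ * F r + _))) = _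
    push_cast
    field_simp
    ring
end

section
/- There is an absolute constant c such that the following holds. Let η ∈ (0, 1/√12], let τ be uniformly distributed on [−√3η, √3η], let g : (0,∞) → ℝ be twice continuously differentiable, and let r > 0. Then E_τ[ ((1−τ)³ g((1−τ)r) − g(r))² ] ≤ c ( η² g(r)² + η² r² g'(r)² + η⁴ r⁴ M₂(r)² ), where M₂(r) = max_{α ∈ [r/2, 2r]} |g''(α)|. -/
open MeasureTheory Real

/-- First-order Taylor estimate on a convex set where the second derivative is bounded. -/
theorem abs_sub_sub_mul_deriv_le {g : ℝ → ℝ} {s : Set ℝ} (hs : Convex ℝ s) {M : ℝ}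
    (hg : ∀ y ∈ s, DifferentiableAt ℝ g y) (hg' : ∀ y ∈ s, DifferentiableAt ℝ (deriv g) y)
    (hM : ∀ y ∈ s, |deriv (deriv g) y| ≤ M) {r x : ℝ} (hr : r ∈ s) (hx : x ∈ s) :
    |g x - g r - (x - r) * deriv g r| ≤ M * (x - r) ^ 2 := by
  have hM0 : 0 ≤ M := (abs_nonneg _).trans (hM r hr)
  have hsub : Set.uIcc r x ⊆ s := by
    rw [← segment_eq_uIcc]
    exact hs.segment_subset hr hx
  have hd : ∀ y ∈ Set.uIcc r x, HasDerivWithinAt (fun z => g z - (z - r) * deriv g r)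
      (deriv g y - deriv g r) (Set.uIcc r x) y := by
    intro y hy
    have h := (hg y (hsub hy)).hasDerivAt.sub
      (((hasDerivAt_id y).sub_const r).mul_const (deriv g r))
    rw [one_mul] at h
    exact h.hasDerivWithinAt
  have hb : ∀ y ∈ Set.uIcc r x, ‖deriv g y - deriv g r‖ ≤ M * |x - r| := by
    intro y hy
    refine (hs.norm_image_sub_le_of_norm_deriv_le hg' hM hr (hsub hy)).trans ?_
    rw [Real.norm_eq_abs]
    exact mul_le_mul_of_nonneg_left (Set.abs_sub_left_of_mem_uIcc hy) hM0
  have h := (convex_uIcc r x).norm_image_sub_le_of_norm_hasDerivWithin_le hd hb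
    Set.left_mem_uIcc Set.right_mem_uIcc
  calc |g x - g r - (x - r) * deriv g r|
      = ‖g x - (x - r) * deriv g r - (g r - (r - r) * deriv g r)‖ := by
        rw [Real.norm_eq_abs]
        congr 1
        ring
    _ ≤ M * |x - r| * |x - r| := h
    _ = M * (x - r) ^ 2 := by rw [mul_assoc, ← sq, sq_abs]

/-- Pointwise form of the second-moment bound, with `a = g r`, `b = r * g' r` and `R` the Taylor
remainder. -/
theorem sq_cube_mul_sub_le {t e a b R N : ℝ} (ht : |t| ≤ 1 / 2) (hte : t ^ 2 ≤ 3 * e)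
    (hR : |R| ≤ N * t ^ 2) :
    ((1 - t) ^ 3 * (a - t * b + R) - a) ^ 2 ≤
      400 * (e * a ^ 2 + e * b ^ 2 + e ^ 2 * N ^ 2) := by
  obtain ⟨h1, h2⟩ := abs_le.1 ht
  have hu0 : 0 ≤ (1 - t) ^ 3 := pow_nonneg (by linarith) 3
  have hu1 : (1 - t) ^ 3 ≤ (3 / 2) ^ 3 := pow_le_pow_left₀ (by linarith) (by linarith) 3
  have hu : ((1 - t) ^ 3) ^ 2 ≤ 12 := by nlinarith
  have hv : (3 - 3 * t + t ^ 2) ^ 2 ≤ 25 := by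
    have h3 : 3 - 3 * t + t ^ 2 ≤ 5 := by nlinarith
    have h4 : 0 ≤ 3 - 3 * t + t ^ 2 := by nlinarith
    nlinarith
  have hR2 : R ^ 2 ≤ 9 * (e ^ 2 * N ^ 2) := by
    calc R ^ 2 = |R| ^ 2 := (sq_abs R).symm
      _ ≤ (N * t ^ 2) ^ 2 := pow_le_pow_left₀ (abs_nonneg R) hR 2
      _ = N ^ 2 * (t ^ 2) ^ 2 := by ring
      _ ≤ N ^ 2 * (3 * e) ^ 2 := by gcongr
      _ = 9 * (e ^ 2 * N ^ 2) := by ring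
  have hA : (3 - 3 * t + t ^ 2) ^ 2 * (t ^ 2 * a ^ 2) ≤ 25 * (3 * e * a ^ 2) := by gcongr
  have hB : ((1 - t) ^ 3) ^ 2 * (t ^ 2 * b ^ 2) ≤ 12 * (3 * e * b ^ 2) := by gcongr
  have hC : ((1 - t) ^ 3) ^ 2 * R ^ 2 ≤ 12 * (9 * (e ^ 2 * N ^ 2)) := by gcongr
  have he : 0 ≤ e := by nlinarith [sq_nonneg t]
  have hea : 0 ≤ e * a ^ 2 := by positivity
  have heb : 0 ≤ e * b ^ 2 := by positivity
  have heN : 0 ≤ e ^ 2 * N ^ 2 := by positivity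
  set p := (3 - 3 * t + t ^ 2) * (t * a) with hp
  set q := (1 - t) ^ 3 * (t * b) with hq
  set w := (1 - t) ^ 3 * R with hw
  have hsplit : (1 - t) ^ 3 * (a - t * b + R) - a = -p - q + w := by
    rw [hp, hq, hw]
    ring
  have hp2 : p ^ 2 ≤ 25 * (3 * e * a ^ 2) := by rw [hp]; linarith
  have hq2 : q ^ 2 ≤ 12 * (3 * e * b ^ 2) := by rw [hq]; linarith
  have hw2 : w ^ 2 ≤ 12 * (9 * (e ^ 2 * N ^ 2)) := by rw [hw]; linarith
  rw [hsplit]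
  nlinarith [sq_nonneg (p - q), sq_nonneg (p + w), sq_nonneg (q + w)]

/-- There is an absolute constant `c` such that for every `η ∈ (0, 1/√12]`, every twice
continuously differentiable `g : (0,∞) → ℝ`, every `r > 0` and `M₂ = max_{α ∈ [r/2,2r]} |g''(α)|`,
if `τ` is uniform on `[-√3η, √3η]` then
`E_τ[((1-τ)³ g((1-τ)r) - g(r))²] ≤ c (η² g(r)² + η² r² g'(r)² + η⁴ r⁴ M₂²)`. -/
theorem stmt11 : ∃ c : ℝ, 0 < c ∧
    ∀ (η : ℝ), 0 < η → η ≤ 1 / Real.sqrt 12 →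
    ∀ (g : ℝ → ℝ), ContDiffOn ℝ 2 g (Set.Ioi 0) →
    ∀ (r : ℝ), 0 < r →
    ∀ (M₂ : ℝ), IsGreatest ((fun α => |deriv (deriv g) α|) '' Set.Icc (r/2) (2*r)) M₂ →
      (2 * Real.sqrt 3 * η)⁻¹ *
          (∫ τ in (-(Real.sqrt 3 * η))..(Real.sqrt 3 * η),
            ((1 - τ)^3 * g ((1 - τ) * r) - g r)^2)
        ≤ c * (η^2 * (g r)^2 + η^2 * r^2 * (deriv g r)^2 + η^4 * r^4 * M₂^2) := by
  refine ⟨400, by norm_num, ?_⟩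
  intro η hη hη' g hg r hr M₂ hM
  have hs : 0 < Real.sqrt 3 * η := by positivity
  have h3 : Real.sqrt 3 ^ 2 = 3 := Real.sq_sqrt (by norm_num)
  have hhalf : Real.sqrt 3 * η ≤ 1 / 2 := by
    have h12 : Real.sqrt 12 = 2 * Real.sqrt 3 := by
      rw [show (12 : ℝ) = 2 ^ 2 * 3 by norm_num, Real.sqrt_mul (by norm_num),
        Real.sqrt_sq (by norm_num)]
    rw [h12, le_div_iff₀ (by positivity)] at hη'
    linarith
  have hpos : ∀ y ∈ Set.Icc (r / 2) (2 * r), y ∈ Set.Ioi (0 : ℝ) :=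
    fun y hy => lt_of_lt_of_le (half_pos hr) hy.1
  have hg1 : ∀ y ∈ Set.Icc (r / 2) (2 * r), DifferentiableAt ℝ g y := fun y hy =>
    (hg.differentiableOn two_ne_zero).differentiableAt (isOpen_Ioi.mem_nhds (hpos y hy))
  have hdg : ContDiffOn ℝ 1 (deriv g) (Set.Ioi 0) :=
    hg.deriv_of_isOpen isOpen_Ioi (by norm_num)
  have hg2 : ∀ y ∈ Set.Icc (r / 2) (2 * r), DifferentiableAt ℝ (deriv g) y := fun y hy =>
    (hdg.differentiableOn one_ne_zero).differentiableAt (isOpen_Ioi.mem_nhds (hpos y hy))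
  have hM' : ∀ y ∈ Set.Icc (r / 2) (2 * r), |deriv (deriv g) y| ≤ M₂ :=
    fun y hy => hM.2 ⟨y, hy, rfl⟩
  set B := 400 * (η ^ 2 * (g r) ^ 2 + η ^ 2 * r ^ 2 * (deriv g r) ^ 2 + η ^ 4 * r ^ 4 * M₂ ^ 2)
    with hB
  have hpt : ∀ t ∈ Set.uIoc (-(Real.sqrt 3 * η)) (Real.sqrt 3 * η),
      ‖((1 - t) ^ 3 * g ((1 - t) * r) - g r) ^ 2‖ ≤ B := by
    intro t ht
    rw [Set.uIoc_of_le (by linarith)] at ht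
    have hts : |t| ≤ Real.sqrt 3 * η := abs_le.2 ⟨ht.1.le, ht.2⟩
    have ht2 : |t| ≤ 1 / 2 := hts.trans hhalf
    have hsq : t ^ 2 ≤ 3 * η ^ 2 := by
      rw [← sq_abs, ← h3, ← mul_pow]
      exact pow_le_pow_left₀ (abs_nonneg t) hts 2
    obtain ⟨hl, hu⟩ := abs_le.1 ht2
    have hT := abs_sub_sub_mul_deriv_le (convex_Icc _ _) hg1 hg2 hM'
      (r := r) (x := (1 - t) * r) ⟨by linarith, by linarith⟩ ⟨by nlinarith, by nlinarith⟩
    have key := sq_cube_mul_sub_le (a := g r) (b := r * deriv g r) (N := M₂ * r ^ 2) ht2 hsq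
      (hT.trans_eq (by ring))
    rw [Real.norm_eq_abs, abs_of_nonneg (sq_nonneg _), hB]
    calc _ = _ := by ring
      _ ≤ _ := key
      _ = _ := by ring
  have hint := (le_abs_self _).trans (intervalIntegral.norm_integral_le_of_norm_le_const hpt)
  rw [sub_neg_eq_add, abs_of_pos (by linarith)] at hint
  rw [inv_mul_le_iff₀ (by positivity)]
  linarith
end

section
/- There is an absolute constant c such that the following holds. Let η ∈ (0, 1/√12], let τ be uniformly distributed on [−√3η, √3η], let g : (0,∞) → ℝ be three times continuously differentiable, and let r > 0. Then E_τ[ ((1−τ)⁴ r g'((1−τ)r) − r g'(r))² ] ≤ c ( η² r² g'(r)² + η² r⁴ g''(r)² + η⁴ r⁶ M₃(r)² ), where M₃(r) = max_{γ ∈ [r/2, 2r]} |g'''(γ)|. -/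
open MeasureTheory Real

/-- First-order Taylor estimate from a bound on the second derivative. -/
theorem abs_sub_sub_mul_le_of_abs_deriv_le {f f' f'' : ℝ → ℝ} {s : Set ℝ} {M x y : ℝ}
    (hs : Convex ℝ s) (hf : ∀ z ∈ s, HasDerivAt f (f' z) z)
    (hf' : ∀ z ∈ s, HasDerivAt f' (f'' z) z) (hM : ∀ z ∈ s, |f'' z| ≤ M)
    (hx : x ∈ s) (hy : y ∈ s) :
    |f y - f x - (y - x) * f' x| ≤ M * (y - x) ^ 2 := by
  have hM₀ : 0 ≤ M := (abs_nonneg _).trans (hM x hx)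
  have hsub : Set.uIcc x y ⊆ s := by
    rw [← segment_eq_uIcc]; exact hs.segment_subset hx hy
  have hlip : ∀ z ∈ Set.uIcc x y, ‖f' z - f' x‖ ≤ M * |y - x| := fun z hz => by
    have h := hs.norm_image_sub_le_of_norm_hasDerivWithin_le
      (fun w hw => (hf' w hw).hasDerivWithinAt) (fun w hw => hM w hw) hx (hsub hz)
    exact h.trans (mul_le_mul_of_nonneg_left (Set.abs_sub_left_of_mem_uIcc hz) hM₀)
  have hderiv : ∀ z ∈ Set.uIcc x y, HasDerivWithinAt (fun z => f z - (z - x) * f' x)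
      (f' z - f' x) (Set.uIcc x y) z := fun z hz => by
    have h := (hf z (hsub hz)).sub (((hasDerivAt_id z).sub_const x).mul_const (f' x))
    rw [one_mul] at h
    exact h.hasDerivWithinAt
  have h := (convex_uIcc x y).norm_image_sub_le_of_norm_hasDerivWithin_le hderiv hlip
    Set.left_mem_uIcc Set.right_mem_uIcc
  rw [Real.norm_eq_abs, Real.norm_eq_abs, mul_assoc, abs_mul_abs_self] at h
  calc |f y - f x - (y - x) * f' x|
      = |f y - (y - x) * f' x - (f x - (x - x) * f' x)| := by congr 1; ring
    _ ≤ M * ((y - x) * (y - x)) := h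
    _ = M * (y - x) ^ 2 := by ring

/-- Squared error of a dilated radial derivative in terms of first-order Taylor data. -/
theorem dilation_error_sq_le {r τ L a a₁ b M : ℝ} (hr : 0 < r) (hM : 0 ≤ M)
    (hτ : |τ| ≤ L) (hL : L ≤ 1 / 2)
    (hb : |b - a - ((1 - τ) * r - r) * a₁| ≤ M * ((1 - τ) * r - r) ^ 2) :
    ((1 - τ) ^ 4 * r * b - r * a) ^ 2 ≤
      243 * (L ^ 2 * r ^ 2 * a ^ 2 + L ^ 2 * r ^ 4 * a₁ ^ 2 + L ^ 4 * r ^ 6 * M ^ 2) := by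
  have hL₀ : 0 ≤ L := (abs_nonneg τ).trans hτ
  obtain ⟨hτ₁, hτ₂⟩ := abs_le.mp (hτ.trans hL)
  have hτsq : τ ^ 2 ≤ L ^ 2 := sq_le_sq.mpr (by rwa [abs_of_nonneg hL₀])
  have hpow : (1 - τ) ^ 4 ≤ 9 := by
    calc (1 - τ) ^ 4 ≤ (3 / 2) ^ 4 := pow_le_pow_left₀ (by linarith) (by linarith) 4
      _ ≤ 9 := by norm_num
  have hpow₀ : 0 ≤ (1 - τ) ^ 4 := by positivity
  have hfac : |(1 - τ) ^ 4 - 1| ≤ 9 * L := by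
    have h : (1 - τ) ^ 4 - 1 = τ * ((1 - τ + 1) * -((1 - τ) ^ 2 + 1)) := by ring
    rw [h, abs_mul]
    have h' : |(1 - τ + 1) * -((1 - τ) ^ 2 + 1)| ≤ 9 := by
      rw [abs_le]
      constructor <;> nlinarith [sq_nonneg (1 - τ),
        mul_nonneg (by linarith : 0 ≤ 1 / 2 + τ) (by linarith : 0 ≤ 1 / 2 - τ)]
    nlinarith [abs_nonneg τ]
  set e := b - a - ((1 - τ) * r - r) * a₁ with he
  have he' : |e| ≤ M * (L ^ 2 * r ^ 2) := hb.trans (by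
    have : ((1 - τ) * r - r) ^ 2 = τ ^ 2 * r ^ 2 := by ring
    rw [this]; gcongr)
  have hsplit : (1 - τ) ^ 4 * r * b - r * a =
      ((1 - τ) ^ 4 - 1) * (r * a) + (1 - τ) ^ 4 * (-τ * r ^ 2 * a₁) + (1 - τ) ^ 4 * (r * e) := by
    rw [he]; ring
  have h₁ : (((1 - τ) ^ 4 - 1) * (r * a)) ^ 2 ≤ 81 * (L ^ 2 * r ^ 2 * a ^ 2) := by
    have h := mul_le_mul_of_nonneg_right (sq_le_sq' (abs_le.mp hfac).1 (abs_le.mp hfac).2)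
      (sq_nonneg (r * a))
    linarith
  have hpow_sq : ((1 - τ) ^ 4) ^ 2 ≤ 81 := by nlinarith
  have h₂ : ((1 - τ) ^ 4 * (-τ * r ^ 2 * a₁)) ^ 2 ≤ 81 * (L ^ 2 * r ^ 4 * a₁ ^ 2) := by
    calc _ = ((1 - τ) ^ 4) ^ 2 * (τ ^ 2 * r ^ 4 * a₁ ^ 2) := by ring
      _ ≤ _ := by gcongr
  have h₃ : ((1 - τ) ^ 4 * (r * e)) ^ 2 ≤ 81 * (L ^ 4 * r ^ 6 * M ^ 2) := by
    have hsq := sq_le_sq' (abs_le.mp he').1 (abs_le.mp he').2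
    calc _ = ((1 - τ) ^ 4) ^ 2 * (r ^ 2 * e ^ 2) := by ring
      _ ≤ 81 * (r ^ 2 * (M * (L ^ 2 * r ^ 2)) ^ 2) := by gcongr
      _ = _ := by ring
  rw [hsplit]
  set A := ((1 - τ) ^ 4 - 1) * (r * a)
  set B := (1 - τ) ^ 4 * (-τ * r ^ 2 * a₁)
  set C := (1 - τ) ^ 4 * (r * e)
  linarith [sq_nonneg (A - B), sq_nonneg (A - C), sq_nonneg (B - C)]

/-- There is an absolute constant `c` such that for every `η ∈ (0, 1/√12]`, every three times
continuously differentiable `g : (0,∞) → ℝ`, every `r > 0` and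
`M₃ = max_{γ ∈ [r/2,2r]} |g'''(γ)|`, if `τ` is uniform on `[-√3η, √3η]` then
`E_τ[((1-τ)⁴ r g'((1-τ)r) - r g'(r))²] ≤ c (η² r² g'(r)² + η² r⁴ g''(r)² + η⁴ r⁶ M₃²)`. -/
theorem stmt12 : ∃ c : ℝ, 0 < c ∧
    ∀ (η : ℝ), 0 < η → η ≤ 1 / Real.sqrt 12 →
    ∀ (g : ℝ → ℝ), ContDiffOn ℝ 3 g (Set.Ioi 0) →
    ∀ (r : ℝ), 0 < r →
    ∀ (M₃ : ℝ),
      IsGreatest ((fun γ => |deriv (deriv (deriv g)) γ|) '' Set.Icc (r/2) (2*r)) M₃ →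
      (2 * Real.sqrt 3 * η)⁻¹ *
          (∫ τ in (-(Real.sqrt 3 * η))..(Real.sqrt 3 * η),
            ((1 - τ)^4 * r * deriv g ((1 - τ) * r) - r * deriv g r)^2)
        ≤ c * (η^2 * r^2 * (deriv g r)^2 + η^2 * r^4 * (deriv (deriv g) r)^2
            + η^4 * r^6 * M₃^2) := by
  refine ⟨2187, by norm_num, fun η hη hη' g hg r hr M hM => ?_⟩
  set L := Real.sqrt 3 * η with hLdef
  have hL₀ : 0 < L := by positivity
  have hLsq : L ^ 2 = 3 * η ^ 2 := by rw [hLdef, mul_pow, Real.sq_sqrt (by norm_num)]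
  have hL : L ≤ 1 / 2 := by
    have h : η ^ 2 ≤ 1 / 12 := by
      calc η ^ 2 ≤ (1 / Real.sqrt 12) ^ 2 := pow_le_pow_left₀ hη.le hη' 2
        _ = 1 / 12 := by rw [div_pow, Real.sq_sqrt (by norm_num), one_pow]
    nlinarith
  have hbound : ∀ γ ∈ Set.Icc (r / 2) (2 * r), |deriv (deriv (deriv g)) γ| ≤ M :=
    fun γ hγ => hM.2 ⟨γ, hγ, rfl⟩
  have hr_mem : r ∈ Set.Icc (r / 2) (2 * r) := ⟨by linarith, by linarith⟩
  have hM₀ : 0 ≤ M := (abs_nonneg _).trans (hbound r hr_mem)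
  have hg' : ContDiffOn ℝ 2 (deriv g) (Set.Ioi 0) :=
    hg.deriv_of_isOpen isOpen_Ioi (by norm_num)
  have hg'' : ContDiffOn ℝ 1 (deriv (deriv g)) (Set.Ioi 0) :=
    hg'.deriv_of_isOpen isOpen_Ioi (by norm_num)
  have hpos : ∀ z ∈ Set.Icc (r / 2) (2 * r), Set.Ioi (0 : ℝ) ∈ nhds z := fun z hz =>
    Ioi_mem_nhds (by linarith [hz.1])
  set K := 243 * (L ^ 2 * r ^ 2 * (deriv g r) ^ 2 + L ^ 2 * r ^ 4 * (deriv (deriv g) r) ^ 2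
    + L ^ 4 * r ^ 6 * M ^ 2) with hK
  have hpoint : ∀ τ ∈ Set.uIoc (-L) L,
      ‖((1 - τ) ^ 4 * r * deriv g ((1 - τ) * r) - r * deriv g r) ^ 2‖ ≤ K := fun τ hτ => by
    rw [Set.uIoc_of_le (by linarith)] at hτ
    have hτL : |τ| ≤ L := abs_le.mpr ⟨hτ.1.le, hτ.2⟩
    rw [Real.norm_of_nonneg (sq_nonneg _)]
    refine dilation_error_sq_le hr hM₀ hτL hL
      (abs_sub_sub_mul_le_of_abs_deriv_le (convex_Icc (r / 2) (2 * r)) (fun z hz => ?_)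
        (fun z hz => ?_) hbound hr_mem ⟨?_, ?_⟩)
    · exact ((hg'.contDiffAt (hpos z hz)).differentiableAt (by norm_num)).hasDerivAt
    · exact ((hg''.contDiffAt (hpos z hz)).differentiableAt (by norm_num)).hasDerivAt
    · nlinarith [hτ.2]
    · nlinarith [hτ.1]
  have hint := (le_abs_self _).trans (intervalIntegral.norm_integral_le_of_norm_le_const hpoint)
  rw [abs_of_pos (by linarith : 0 < L - -L)] at hint
  have hηL : 2 * Real.sqrt 3 * η = 2 * L := by rw [hLdef]; ring
  rw [hηL, inv_mul_le_iff₀ (by positivity)]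
  have hL4 : L ^ 4 = 9 * η ^ 4 := by
    calc L ^ 4 = (L ^ 2) ^ 2 := by ring
      _ = 9 * η ^ 4 := by rw [hLsq]; ring
  have hKle : K ≤ 2187 * (η ^ 2 * r ^ 2 * (deriv g r) ^ 2 + η ^ 2 * r ^ 4 * (deriv (deriv g) r) ^ 2
      + η ^ 4 * r ^ 6 * M ^ 2) := by
    rw [hK, hLsq, hL4]
    have h₁ : 0 ≤ η ^ 2 * r ^ 2 * (deriv g r) ^ 2 := by positivity
    have h₂ : 0 ≤ η ^ 2 * r ^ 4 * (deriv (deriv g) r) ^ 2 := by positivity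
    linarith
  calc _ ≤ K * (L - -L) := hint
    _ = 2 * L * K := by ring
    _ ≤ _ := by gcongr
end
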